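/- (i) For all a>0, ℓ>0: |∂²ₐp(a,ℓ)| ≈ a^{-4}·⟨a√ℓ⟩ and |∂²ₐκ(a,ℓ)| ≲ a^{-2}·⟨a√ℓ⟩^{-1}·min(1, a²ℓ). (ii) For all θ ≠ 0, a>0, ℓ>0, writing R = R(θ,a,ℓ), p = p(a,ℓ): |∂²_θR| ≲ p/R² ≲ a^{-2}ℓ^{-2}·⟨a√ℓ⟩³, |∂²_{θa}R| ≲ (1/a)·(p/R) ≲ (1/a)·⟨1/(a√ℓ)⟩², and |∂²ₐR| ≲ (p/a²)·ln⟨R/p⟩. -/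

import Mathlib

noncomputable section

open Real MeasureTheory Set Filter

/-- Japanese bracket `⟨x⟩ := √(2+x²)`. -/
def jb (x : ℝ) : ℝ := Real.sqrt (2 + x ^ 2)

/-- `κ(a,ℓ) := (1 + 4a²ℓ/m²)^{-1/2}`. -/
def kpa (m a ℓ : ℝ) : ℝ := 1 / Real.sqrt (1 + 4 * a ^ 2 * ℓ / m ^ 2)

/-- `p(a,ℓ) := m / (2a²κ(a,ℓ))`. -/
def pfn (m a ℓ : ℝ) : ℝ := m / (2 * a ^ 2 * kpa m a ℓ)

/-- `r₀(a,ℓ) := p(a,ℓ)(1-κ(a,ℓ))`. -/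
def rZero (m a ℓ : ℝ) : ℝ := pfn m a ℓ * (1 - kpa m a ℓ)

/-- `G_κ(y) := √(y²-1) - κ ln(y + √(y²-1))`. -/
def Gf (κ y : ℝ) : ℝ := Real.sqrt (y ^ 2 - 1) - κ * Real.log (y + Real.sqrt (y ^ 2 - 1))

/-- `H_κ : [0,∞) → [1,∞)`, the inverse of `G_κ` on `[1,∞)`. -/
def Hf (κ x : ℝ) : ℝ := Function.invFunOn (Gf κ) (Set.Ici 1) x

/-- Inverse hyperbolic cosine `arcosh x = ln (x + √(x²-1))`. -/
def acosh (x : ℝ) : ℝ := Real.log (x + Real.sqrt (x ^ 2 - 1))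

/-- The radial function `R(θ,a,ℓ)`. -/
def Rf (m θ a ℓ : ℝ) : ℝ :=
  pfn m a ℓ * Hf (kpa m a ℓ) (|θ| / pfn m a ℓ) - pfn m a ℓ * kpa m a ℓ

/-- The radial velocity `V(θ,a,ℓ)`. -/
def Vf (m θ a ℓ : ℝ) : ℝ :=
  Real.sign θ * a *
    Real.sqrt (1 + m / (a ^ 2 * Rf m θ a ℓ) - ℓ / (a ^ 2 * (Rf m θ a ℓ) ^ 2))

/-- The dynamical radial function `R̃(t,θ,a,ℓ) = R(θ+at,a,ℓ)`. -/
def Rtil (m t θ a ℓ : ℝ) : ℝ := Rf m (θ + a * t) a ℓ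

/-- The action `𝒜(r,v,ℓ) = √(v² - m/r + ℓ/r²)`. -/
def Acal (m r v ℓ : ℝ) : ℝ := Real.sqrt (v ^ 2 - m / r + ℓ / r ^ 2)

/-- The angle `Θ(r,v,ℓ) = sgn(v)·p(𝒜,ℓ)·G_{κ(𝒜,ℓ)}(r/p(𝒜,ℓ) + κ(𝒜,ℓ))`. -/
def Theta (m r v ℓ : ℝ) : ℝ :=
  Real.sign v * pfn m (Acal m r v ℓ) ℓ *
    Gf (kpa m (Acal m r v ℓ) ℓ) (r / pfn m (Acal m r v ℓ) ℓ + kpa m (Acal m r v ℓ) ℓ)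

/-- The phase space `ℝ×(0,∞)×(0,∞)` in the variables `(θ,a,ℓ)`. -/
def phaseSet : Set (ℝ × ℝ × ℝ) := Set.univ ×ˢ Set.Ioi 0 ×ˢ Set.Ioi 0

/-- The gravitational field
`F(t,r) = -(1/r²)·∫∫∫ 1_{R(θ+ta,a,ℓ) ≤ r} γ(θ,a,ℓ)² dθ da dℓ`. -/
def gravF (m : ℝ) (γ : ℝ × ℝ × ℝ → ℝ) (t r : ℝ) : ℝ :=
  -(1 / r ^ 2) *
    (∫⁻ x in {x : ℝ × ℝ × ℝ | Rf m (x.1 + t * x.2.1) x.2.1 x.2.2 ≤ r},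
        ENNReal.ofReal ((γ x) ^ 2) ∂(volume.restrict phaseSet)).toReal

/-- The effective gravitational field
`F_eff(t,r) = -(1/r²)·∫∫∫ 1_{at ≤ r} γ(θ,a,ℓ)² dθ da dℓ`. -/
def gravFeff (γ : ℝ × ℝ × ℝ → ℝ) (t r : ℝ) : ℝ :=
  -(1 / r ^ 2) *
    (∫⁻ x in {x : ℝ × ℝ × ℝ | x.2.1 * t ≤ r},
        ENNReal.ofReal ((γ x) ^ 2) ∂(volume.restrict phaseSet)).toReal


/-! ### The parametrization `y = cosh u` -/

theorem gk_strictMono (k : ℝ) (hk : k < 1) : StrictMono (fun u : ℝ => Real.sinh u - k * u) := by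
  intro u v huv
  have h : Real.sinh u - u < Real.sinh v - v := Real.sinh_sub_id_strictMono huv
  show Real.sinh u - k * u < Real.sinh v - k * v
  nlinarith

theorem gk_lower (k : ℝ) (u v : ℝ) (huv : u ≤ v) :
    (1 - k) * (v - u) ≤ (Real.sinh v - k * v) - (Real.sinh u - k * u) := by
  have h : Real.sinh u - u ≤ Real.sinh v - v := Real.sinh_sub_id_strictMono.monotone huv
  nlinarith

theorem gk_lower_abs (k : ℝ) (u v : ℝ) :
    (1 - k) * |v - u| ≤ |(Real.sinh v - k * v) - (Real.sinh u - k * u)| := by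
  rcases le_total u v with h | h
  · rw [abs_of_nonneg (sub_nonneg.2 h)]
    exact (gk_lower k u v h).trans (le_abs_self _)
  · rw [abs_sub_comm v u, abs_of_nonneg (sub_nonneg.2 h), abs_sub_comm]
    exact (gk_lower k v u h).trans (le_abs_self _)

theorem gk_surj (k : ℝ) (hk : k < 1) : Function.Surjective (fun u : ℝ => Real.sinh u - k * u) := by
  have hc : Continuous (fun u : ℝ => Real.sinh u - k * u) := by fun_prop
  apply hc.surjective
  · have h1 : Tendsto (fun u : ℝ => (1 - k) * u) atTop atTop :=
      tendsto_id.const_mul_atTop (by linarith)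
    refine tendsto_atTop_mono' _ ?_ h1
    filter_upwards [eventually_ge_atTop 0] with u hu
    have := gk_lower k 0 u hu
    simp at this
    linarith
  · have h1 : Tendsto (fun u : ℝ => (1 - k) * u) atBot atBot :=
      tendsto_id.const_mul_atBot (by linarith)
    refine tendsto_atBot_mono' _ ?_ h1
    filter_upwards [eventually_le_atBot 0] with u hu
    have := gk_lower k u 0 hu
    simp at this
    linarith

/-- Inverse of `u ↦ sinh u - k u`. -/
def Uf (k x : ℝ) : ℝ := Function.invFun (fun u : ℝ => Real.sinh u - k * u) x

theorem Uf_eq (k x : ℝ) (hk : k < 1) : Real.sinh (Uf k x) - k * Uf k x = x :=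
  Function.invFun_eq (f := fun u : ℝ => Real.sinh u - k * u) (gk_surj k hk x)

theorem Uf_unique (k x u : ℝ) (hk : k < 1) (h : Real.sinh u - k * u = x) : u = Uf k x := by
  apply (gk_strictMono k hk).injective
  show Real.sinh u - k * u = Real.sinh (Uf k x) - k * Uf k x
  rw [h, Uf_eq k x hk]

theorem Uf_nonneg (k x : ℝ) (hk : k < 1) (hx : 0 ≤ x) : 0 ≤ Uf k x := by
  apply (gk_strictMono k hk).le_iff_le.1
  show Real.sinh 0 - k * 0 ≤ Real.sinh (Uf k x) - k * Uf k x
  rw [Uf_eq k x hk]; simpa using hx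

theorem Uf_neg (k x : ℝ) (hk : k < 1) : Uf k (-x) = - Uf k x := by
  symm
  apply Uf_unique k _ _ hk
  rw [Real.sinh_neg]
  have := Uf_eq k x hk
  linarith

theorem Gf_cosh (k u : ℝ) (hu : 0 ≤ u) : Gf k (Real.cosh u) = Real.sinh u - k * u := by
  have h1 : Real.cosh u ^ 2 - 1 = Real.sinh u ^ 2 := by
    have := Real.cosh_sq u; linarith
  unfold Gf
  rw [h1, Real.sqrt_sq (Real.sinh_nonneg_iff.2 hu), Real.cosh_add_sinh, Real.log_exp]

theorem Hf_eq (k x : ℝ) (hk : k < 1) (hx : 0 ≤ x) : Hf k x = Real.cosh (Uf k x) := by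
  have hex : ∃ y ∈ Set.Ici (1 : ℝ), Gf k y = x :=
    ⟨Real.cosh (Uf k x), Real.one_le_cosh _, by
      rw [Gf_cosh k _ (Uf_nonneg k x hk hx), Uf_eq k x hk]⟩
  have h1 : Hf k x ∈ Set.Ici (1 : ℝ) := Function.invFunOn_mem hex
  have h2 : Gf k (Hf k x) = x := Function.invFunOn_eq hex
  have h3 := Real.cosh_arcosh h1
  have h4 : 0 ≤ Real.arcosh (Hf k x) := Real.arcosh_nonneg h1
  rw [← h3, Gf_cosh k _ h4] at h2
  rw [← Uf_unique k x _ hk h2, h3]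

theorem cosh_Uf_abs (k x : ℝ) (hk : k < 1) : Real.cosh (Uf k |x|) = Real.cosh (Uf k x) := by
  rcases abs_choice x with h | h
  · rw [h]
  · rw [h, Uf_neg k x hk, Real.cosh_neg]

/-- Implicit differentiation. -/
theorem implicit_deriv (k x u : ℝ → ℝ) (k' x' t : ℝ) (hk : HasDerivAt k k' t)
    (hx : HasDerivAt x x' t) (hkt : k t < 1)
    (hu : ∀ᶠ s in nhds t, Real.sinh (u s) - k s * u s = x s) :
    HasDerivAt u ((x' + k' * u t) / (Real.cosh (u t) - k t)) t := by
  set r : ℝ → ℝ := fun s => x s - (Real.sinh (u t) - k s * u t) with hr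
  have hr0 : r t = 0 := by have := hu.self_of_nhds; simp only [hr]; linarith
  have hrd : HasDerivAt r (x' + k' * u t) t := by
    have := hx.sub ((hasDerivAt_const t (Real.sinh (u t))).sub (hk.mul_const (u t)))
    exact this.congr_deriv (by ring)
  have hlt : ∀ᶠ s in nhds t, k s < 1 := hk.continuousAt.eventually_lt_const hkt
  have hcont : ContinuousAt u t := by
    rw [ContinuousAt, tendsto_iff_norm_sub_tendsto_zero]
    have hb : Tendsto (fun s => |r s| / (1 - k s)) (nhds t) (nhds 0) := by
      have h1 : ContinuousAt (fun s => |r s| / (1 - k s)) t := by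
        apply ContinuousAt.div
        · exact hrd.continuousAt.abs
        · exact continuousAt_const.sub hk.continuousAt
        · linarith
      have := h1.tendsto
      simpa [hr0] using this
    refine squeeze_zero' (Eventually.of_forall fun s => norm_nonneg _) ?_ hb
    filter_upwards [hlt, hu] with s h1 h2
    rw [le_div_iff₀ (by linarith), Real.norm_eq_abs, mul_comm]
    have := gk_lower_abs (k s) (u t) (u s)
    rw [h2] at this
    exact this
  set c : ℝ → ℝ := fun s => (dslope Real.sinh (u t) (u s) - k s)⁻¹ with hc
  have hne : Real.cosh (u t) - k t ≠ 0 := by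
    have := Real.one_le_cosh (u t); linarith
  have hds : dslope Real.sinh (u t) (u t) = Real.cosh (u t) := by
    rw [dslope_same, Real.deriv_sinh]
  have hcc : ContinuousAt c t := by
    apply ContinuousAt.inv₀
    · apply ContinuousAt.sub _ hk.continuousAt
      apply ContinuousAt.comp (g := dslope Real.sinh (u t)) _ hcont
      exact continuousAt_dslope_same.2 Real.differentiable_sinh.differentiableAt
    · rw [hds]; exact hne
  have hcne : ∀ᶠ s in nhds t, dslope Real.sinh (u t) (u s) - k s ≠ 0 := by
    have : ContinuousAt (fun s => dslope Real.sinh (u t) (u s) - k s) t := by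
      apply ContinuousAt.sub _ hk.continuousAt
      apply ContinuousAt.comp (g := dslope Real.sinh (u t)) _ hcont
      exact continuousAt_dslope_same.2 Real.differentiable_sinh.differentiableAt
    apply this.eventually_ne
    rw [hds]; exact hne
  have hue : ∀ᶠ s in nhds t, u s = u t + r s * c s := by
    filter_upwards [hu, hcne] with s h1 h2
    have h3 : (u s - u t) * dslope Real.sinh (u t) (u s) = Real.sinh (u s) - Real.sinh (u t) := by
      have := sub_smul_dslope Real.sinh (u t) (u s)
      simpa using this
    simp only [hr, hc]
    field_simp
    linear_combination h3 + h1
  have hmain : HasDerivAt (fun s => u t + r s * c s) ((x' + k' * u t) / (Real.cosh (u t) - k t)) t := by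
    apply HasDerivAt.const_add
    rw [hasDerivAt_iff_tendsto_slope]
    have h1 := (hasDerivAt_iff_tendsto_slope.1 hrd).mul (hcc.tendsto.mono_left nhdsWithin_le_nhds)
    have h2 : c t = (Real.cosh (u t) - k t)⁻¹ := by simp only [hc]; rw [hds]
    rw [h2, ← div_eq_mul_inv] at h1
    refine h1.congr' ?_
    filter_upwards with s
    simp only [slope, vsub_eq_sub, hr0, smul_eq_mul]
    ring
  exact hmain.congr_of_eventuallyEq hue

/-! ### Derivatives -/

theorem rad_pos (m a ℓ : ℝ) (hm : 0 < m) (hl : 0 < ℓ) : 0 < 1 + 4 * a ^ 2 * ℓ / m ^ 2 := by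
  positivity

theorem kpa_pos (m a ℓ : ℝ) (hm : 0 < m) (hl : 0 < ℓ) : 0 < kpa m a ℓ := by
  have := rad_pos m a ℓ hm hl
  unfold kpa; positivity

theorem kpa_sq (m a ℓ : ℝ) (hm : 0 < m) (hl : 0 < ℓ) :
    kpa m a ℓ ^ 2 * (1 + 4 * a ^ 2 * ℓ / m ^ 2) = 1 := by
  have h := rad_pos m a ℓ hm hl
  unfold kpa
  rw [div_pow, Real.sq_sqrt h.le, one_pow, one_div_mul_cancel h.ne']

theorem kpa_lt_one (m a ℓ : ℝ) (hm : 0 < m) (ha : 0 < a) (hl : 0 < ℓ) : kpa m a ℓ < 1 := by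
  have h := kpa_sq m a ℓ hm hl
  have h0 := kpa_pos m a ℓ hm hl
  have h1 : 0 < 4 * a ^ 2 * ℓ / m ^ 2 := by positivity
  have h2 : 0 < kpa m a ℓ ^ 2 * (4 * a ^ 2 * ℓ / m ^ 2) := by positivity
  nlinarith

theorem pfn_pos (m a ℓ : ℝ) (hm : 0 < m) (ha : 0 < a) (hl : 0 < ℓ) : 0 < pfn m a ℓ := by
  have h0 := kpa_pos m a ℓ hm hl
  unfold pfn; positivity

theorem kpa_deriv (m a ℓ : ℝ) (hm : 0 < m) (ha : 0 < a) (hl : 0 < ℓ) :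
    HasDerivAt (fun a' => kpa m a' ℓ) (-(kpa m a ℓ * (1 - kpa m a ℓ ^ 2) / a)) a := by
  have h := rad_pos m a ℓ hm hl
  have h1 : HasDerivAt (fun a' : ℝ => 1 + 4 * a' ^ 2 * ℓ / m ^ 2) (8 * a * ℓ / m ^ 2) a := by
    have := ((((hasDerivAt_pow 2 a).const_mul 4).mul_const ℓ).div_const (m ^ 2)).const_add 1
    refine this.congr_deriv ?_
    push_cast
    ring
  have h2 := ((h1.sqrt h.ne').inv (Real.sqrt_pos.2 h).ne')
  have h3 : (fun a' => kpa m a' ℓ) = fun a' => (Real.sqrt (1 + 4 * a' ^ 2 * ℓ / m ^ 2))⁻¹ := by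
    funext a'; unfold kpa; rw [one_div]
  rw [h3]
  refine h2.congr_deriv ?_
  have hq : 0 < Real.sqrt (1 + 4 * a ^ 2 * ℓ / m ^ 2) := Real.sqrt_pos.2 h
  have hq2 : Real.sqrt (1 + 4 * a ^ 2 * ℓ / m ^ 2) ^ 2 = 1 + 4 * a ^ 2 * ℓ / m ^ 2 :=
    Real.sq_sqrt h.le
  unfold kpa
  set q := Real.sqrt (1 + 4 * a ^ 2 * ℓ / m ^ 2)
  have hq3 : q ^ 2 * m ^ 2 = m ^ 2 + 4 * a ^ 2 * ℓ := by
    rw [hq2]; field_simp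
  field_simp
  linear_combination 2 * hq3

theorem pfn_deriv (m a ℓ : ℝ) (hm : 0 < m) (ha : 0 < a) (hl : 0 < ℓ) :
    HasDerivAt (fun a' => pfn m a' ℓ) (-((1 + kpa m a ℓ ^ 2) * pfn m a ℓ / a)) a := by
  have hk := kpa_deriv m a ℓ hm ha hl
  have hk0 := kpa_pos m a ℓ hm hl
  have h1 : HasDerivAt (fun a' => m / (2 * a' ^ 2 * kpa m a' ℓ)) _ a :=
    (hasDerivAt_const a m).div (((hasDerivAt_pow 2 a).const_mul 2).mul hk) (by simp; constructor <;> positivity)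
  refine h1.congr_deriv ?_
  unfold pfn
  set k := kpa m a ℓ
  push_cast
  field_simp
  ring

theorem ev_pos (a : ℝ) (ha : 0 < a) : ∀ᶠ s in nhds a, 0 < s := eventually_gt_nhds ha

theorem kpa_deriv2 (m a ℓ : ℝ) (hm : 0 < m) (ha : 0 < a) (hl : 0 < ℓ) :
    deriv (fun a' => deriv (fun a'' => kpa m a'' ℓ) a') a =
      kpa m a ℓ * (1 - kpa m a ℓ ^ 2) * (2 - 3 * kpa m a ℓ ^ 2) / a ^ 2 := by
  have he : (fun a' => deriv (fun a'' => kpa m a'' ℓ) a') =ᶠ[nhds a]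
      fun a' => -(kpa m a' ℓ * (1 - kpa m a' ℓ ^ 2) / a') := by
    filter_upwards [ev_pos a ha] with s hs
    exact (kpa_deriv m s ℓ hm hs hl).deriv
  rw [he.deriv_eq]
  have hk := kpa_deriv m a ℓ hm ha hl
  have h1 : HasDerivAt (fun a' => -(kpa m a' ℓ * (1 - kpa m a' ℓ ^ 2) / a')) _ a :=
    ((hk.mul ((hasDerivAt_const a (1 : ℝ)).sub (hk.pow 2))).div (hasDerivAt_id a) ha.ne').neg
  rw [h1.deriv]
  simp only [Pi.mul_apply, Pi.sub_apply, Pi.pow_apply, id]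
  set k := kpa m a ℓ
  push_cast
  field_simp
  ring

theorem pfn_deriv2 (m a ℓ : ℝ) (hm : 0 < m) (ha : 0 < a) (hl : 0 < ℓ) :
    deriv (fun a' => deriv (fun a'' => pfn m a'' ℓ) a') a =
      pfn m a ℓ * (2 + 5 * kpa m a ℓ ^ 2 - kpa m a ℓ ^ 4) / a ^ 2 := by
  have he : (fun a' => deriv (fun a'' => pfn m a'' ℓ) a') =ᶠ[nhds a]
      fun a' => -((1 + kpa m a' ℓ ^ 2) * pfn m a' ℓ / a') := by
    filter_upwards [ev_pos a ha] with s hs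
    exact (pfn_deriv m s ℓ hm hs hl).deriv
  rw [he.deriv_eq]
  have hk := kpa_deriv m a ℓ hm ha hl
  have hp := pfn_deriv m a ℓ hm ha hl
  have h1 : HasDerivAt (fun a' => -((1 + kpa m a' ℓ ^ 2) * pfn m a' ℓ / a')) _ a :=
    (((((hasDerivAt_const a (1 : ℝ)).add (hk.pow 2))).mul hp).div (hasDerivAt_id a) ha.ne').neg
  rw [h1.deriv]
  simp only [Pi.mul_apply, Pi.add_apply, Pi.pow_apply, id]
  set k := kpa m a ℓ
  set p := pfn m a ℓ
  push_cast
  field_simp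
  ring

/-- The hyperbolic angle. -/
def uu (m θ a ℓ : ℝ) : ℝ := Uf (kpa m a ℓ) (θ / pfn m a ℓ)

theorem uu_eq (m θ a ℓ : ℝ) (hm : 0 < m) (ha : 0 < a) (hl : 0 < ℓ) :
    Real.sinh (uu m θ a ℓ) - kpa m a ℓ * uu m θ a ℓ = θ / pfn m a ℓ :=
  Uf_eq _ _ (kpa_lt_one m a ℓ hm ha hl)

theorem Rf_eq (m θ a ℓ : ℝ) (hm : 0 < m) (ha : 0 < a) (hl : 0 < ℓ) :
    Rf m θ a ℓ = pfn m a ℓ * (Real.cosh (uu m θ a ℓ) - kpa m a ℓ) := by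
  have hp := pfn_pos m a ℓ hm ha hl
  have hk := kpa_lt_one m a ℓ hm ha hl
  unfold Rf uu
  rw [Hf_eq _ _ hk (by positivity), ← cosh_Uf_abs _ (θ / pfn m a ℓ) hk, abs_div, abs_of_pos hp]
  ring

theorem D_pos (m θ a ℓ : ℝ) (hm : 0 < m) (ha : 0 < a) (hl : 0 < ℓ) :
    0 < Real.cosh (uu m θ a ℓ) - kpa m a ℓ := by
  have hk := kpa_lt_one m a ℓ hm ha hl
  have := Real.one_le_cosh (uu m θ a ℓ)
  linarith

theorem uu_deriv_theta (m θ a ℓ : ℝ) (hm : 0 < m) (ha : 0 < a) (hl : 0 < ℓ) :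
    HasDerivAt (fun θ' => uu m θ' a ℓ)
      (1 / (pfn m a ℓ * (Real.cosh (uu m θ a ℓ) - kpa m a ℓ))) θ := by
  have hp := pfn_pos m a ℓ hm ha hl
  have hD := D_pos m θ a ℓ hm ha hl
  have h := implicit_deriv (fun _ => kpa m a ℓ) (fun θ' => θ' / pfn m a ℓ)
    (fun θ' => uu m θ' a ℓ) 0 (1 / pfn m a ℓ) θ (hasDerivAt_const _ _)
    ((hasDerivAt_id θ).div_const _) (kpa_lt_one m a ℓ hm ha hl)
    (Eventually.of_forall fun s => uu_eq m s a ℓ hm ha hl)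
  refine h.congr_deriv ?_
  field_simp
  ring

/-- The numerator of `a ∂ₐ u`. -/
def Wf (k u : ℝ) : ℝ := (1 + k ^ 2) * Real.sinh u - 2 * k * u

theorem uu_deriv_a (m θ a ℓ : ℝ) (hm : 0 < m) (ha : 0 < a) (hl : 0 < ℓ) :
    HasDerivAt (fun a' => uu m θ a' ℓ)
      (Wf (kpa m a ℓ) (uu m θ a ℓ) / (a * (Real.cosh (uu m θ a ℓ) - kpa m a ℓ))) a := by
  have hp := pfn_pos m a ℓ hm ha hl
  have hD := D_pos m θ a ℓ hm ha hl
  have hx : HasDerivAt (fun a' => θ / pfn m a' ℓ) _ a :=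
    (hasDerivAt_const a θ).div (pfn_deriv m a ℓ hm ha hl) hp.ne'
  have h := implicit_deriv (fun a' => kpa m a' ℓ) (fun a' => θ / pfn m a' ℓ)
    (fun a' => uu m θ a' ℓ) _ _ a (kpa_deriv m a ℓ hm ha hl) hx (kpa_lt_one m a ℓ hm ha hl)
    (by filter_upwards [ev_pos a ha] with s hs using uu_eq m θ s ℓ hm hs hl)
  refine h.congr_deriv ?_
  have he := uu_eq m θ a ℓ hm ha hl
  have he' : θ = (Real.sinh (uu m θ a ℓ) - kpa m a ℓ * uu m θ a ℓ) * pfn m a ℓ := by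
    rw [he]; field_simp
  unfold Wf
  set u := uu m θ a ℓ
  set k := kpa m a ℓ
  set p := pfn m a ℓ
  rw [he']
  field_simp
  ring

theorem Rf_deriv_theta (m θ a ℓ : ℝ) (hm : 0 < m) (ha : 0 < a) (hl : 0 < ℓ) :
    deriv (fun θ' => Rf m θ' a ℓ) θ =
      Real.sinh (uu m θ a ℓ) / (Real.cosh (uu m θ a ℓ) - kpa m a ℓ) := by
  have hp := pfn_pos m a ℓ hm ha hl
  have hD := D_pos m θ a ℓ hm ha hl
  have hf : (fun θ' => Rf m θ' a ℓ) =
      fun θ' => pfn m a ℓ * (Real.cosh (uu m θ' a ℓ) - kpa m a ℓ) := by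
    funext s; exact Rf_eq m s a ℓ hm ha hl
  rw [hf]
  have h := (((uu_deriv_theta m θ a ℓ hm ha hl).cosh).sub_const (kpa m a ℓ)).const_mul (pfn m a ℓ)
  rw [h.deriv]
  field_simp

theorem Rf_deriv_theta2 (m θ a ℓ : ℝ) (hm : 0 < m) (ha : 0 < a) (hl : 0 < ℓ) :
    deriv (fun θ' => deriv (fun θ'' => Rf m θ'' a ℓ) θ') θ =
      (1 - kpa m a ℓ * Real.cosh (uu m θ a ℓ)) /
        (pfn m a ℓ * (Real.cosh (uu m θ a ℓ) - kpa m a ℓ) ^ 3) := by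
  have hp := pfn_pos m a ℓ hm ha hl
  have hD := D_pos m θ a ℓ hm ha hl
  have hf : (fun θ' => deriv (fun θ'' => Rf m θ'' a ℓ) θ') =
      fun θ' => Real.sinh (uu m θ' a ℓ) / (Real.cosh (uu m θ' a ℓ) - kpa m a ℓ) := by
    funext s; exact Rf_deriv_theta m s a ℓ hm ha hl
  rw [hf]
  have hu := uu_deriv_theta m θ a ℓ hm ha hl
  have h : HasDerivAt (fun θ' => Real.sinh (uu m θ' a ℓ) / (Real.cosh (uu m θ' a ℓ) - kpa m a ℓ)) _ θ :=
    hu.sinh.div (hu.cosh.sub_const (kpa m a ℓ)) hD.ne'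
  rw [h.deriv]
  have hc := Real.cosh_sq (uu m θ a ℓ)
  set y := Real.cosh (uu m θ a ℓ)
  set S := Real.sinh (uu m θ a ℓ)
  set k := kpa m a ℓ
  set p := pfn m a ℓ
  field_simp
  linear_combination hc

theorem Rf_deriv_mixed (m θ a ℓ : ℝ) (hm : 0 < m) (ha : 0 < a) (hl : 0 < ℓ) :
    deriv (fun a' => deriv (fun θ' => Rf m θ' a' ℓ) θ) a =
      (1 / a) * ((1 - kpa m a ℓ * Real.cosh (uu m θ a ℓ)) * Wf (kpa m a ℓ) (uu m θ a ℓ) /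
        (Real.cosh (uu m θ a ℓ) - kpa m a ℓ) ^ 3 -
        kpa m a ℓ * (1 - kpa m a ℓ ^ 2) * Real.sinh (uu m θ a ℓ) /
        (Real.cosh (uu m θ a ℓ) - kpa m a ℓ) ^ 2) := by
  have hp := pfn_pos m a ℓ hm ha hl
  have hD := D_pos m θ a ℓ hm ha hl
  have hf : (fun a' => deriv (fun θ' => Rf m θ' a' ℓ) θ) =ᶠ[nhds a]
      fun a' => Real.sinh (uu m θ a' ℓ) / (Real.cosh (uu m θ a' ℓ) - kpa m a' ℓ) := by
    filter_upwards [ev_pos a ha] with s hs using Rf_deriv_theta m θ s ℓ hm hs hl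
  rw [hf.deriv_eq]
  have hu := uu_deriv_a m θ a ℓ hm ha hl
  have hk := kpa_deriv m a ℓ hm ha hl
  have h : HasDerivAt (fun a' => Real.sinh (uu m θ a' ℓ) /
      (Real.cosh (uu m θ a' ℓ) - kpa m a' ℓ)) _ a :=
    hu.sinh.div (hu.cosh.sub hk) hD.ne'
  rw [h.deriv]
  have hc := Real.cosh_sq (uu m θ a ℓ)
  set W := Wf (kpa m a ℓ) (uu m θ a ℓ)
  set y := Real.cosh (uu m θ a ℓ)
  set S := Real.sinh (uu m θ a ℓ)
  set k := kpa m a ℓ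
  set p := pfn m a ℓ
  field_simp
  linear_combination W * hc

/-- `a ∂ₐ R = p B / D`. -/
def Bf (k u : ℝ) : ℝ :=
  (3 * k + k ^ 3) * Real.cosh u - (1 + 3 * k ^ 2) - 2 * k * (u * Real.sinh u)

theorem Rf_deriv_a (m θ a ℓ : ℝ) (hm : 0 < m) (ha : 0 < a) (hl : 0 < ℓ) :
    deriv (fun a' => Rf m θ a' ℓ) a =
      pfn m a ℓ * Bf (kpa m a ℓ) (uu m θ a ℓ) /
        (a * (Real.cosh (uu m θ a ℓ) - kpa m a ℓ)) := by
  have hp := pfn_pos m a ℓ hm ha hl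
  have hD := D_pos m θ a ℓ hm ha hl
  have hf : (fun a' => Rf m θ a' ℓ) =ᶠ[nhds a]
      fun a' => pfn m a' ℓ * (Real.cosh (uu m θ a' ℓ) - kpa m a' ℓ) := by
    filter_upwards [ev_pos a ha] with s hs using Rf_eq m θ s ℓ hm hs hl
  rw [hf.deriv_eq]
  have hu := uu_deriv_a m θ a ℓ hm ha hl
  have hk := kpa_deriv m a ℓ hm ha hl
  have h : HasDerivAt (fun a' => pfn m a' ℓ * (Real.cosh (uu m θ a' ℓ) - kpa m a' ℓ)) _ a :=
    (pfn_deriv m a ℓ hm ha hl).mul (hu.cosh.sub hk)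
  rw [h.deriv]
  have hc := Real.cosh_sq (uu m θ a ℓ)
  unfold Wf Bf
  set u := uu m θ a ℓ
  set y := Real.cosh u
  set S := Real.sinh u
  set k := kpa m a ℓ
  set p := pfn m a ℓ
  field_simp
  linear_combination (-(1 + k ^ 2)) * hc

/-- `a² ∂ₐ² R = p J`. -/
def Jf (k u : ℝ) : ℝ :=
  -(2 + k ^ 2) * (Bf k u / (Real.cosh u - k)) +
    ((k * (1 + k ^ 2) * Real.sinh u - 2 * k * u * Real.cosh u) * Wf k u / (Real.cosh u - k) ^ 2
      - Bf k u * Real.sinh u * Wf k u / (Real.cosh u - k) ^ 3)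
    - k * (1 - k ^ 2) * (((3 + 3 * k ^ 2) * Real.cosh u - 6 * k - 2 * (u * Real.sinh u)) /
        (Real.cosh u - k) + Bf k u / (Real.cosh u - k) ^ 2)

theorem Bf_deriv (k u : ℝ → ℝ) (k' u' t : ℝ) (hk : HasDerivAt k k' t) (hu : HasDerivAt u u' t) :
    HasDerivAt (fun s => Bf (k s) (u s))
      ((k t * (1 + k t ^ 2) * Real.sinh (u t) - 2 * k t * u t * Real.cosh (u t)) * u' +
      ((3 + 3 * k t ^ 2) * Real.cosh (u t) - 6 * k t - 2 * (u t * Real.sinh (u t))) * k') t := by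
  have h : HasDerivAt (fun s => Bf (k s) (u s)) _ t :=
    ((((hk.const_mul 3).add (hk.pow 3)).mul hu.cosh).sub
      ((hasDerivAt_const t (1 : ℝ)).add ((hk.pow 2).const_mul 3))).sub
      ((hk.const_mul 2).mul (hu.mul hu.sinh))
  refine h.congr_deriv ?_
  simp only [Pi.add_apply, Pi.pow_apply]
  push_cast
  ring

theorem Rf_deriv_a2 (m θ a ℓ : ℝ) (hm : 0 < m) (ha : 0 < a) (hl : 0 < ℓ) :
    deriv (fun a' => deriv (fun a'' => Rf m θ a'' ℓ) a') a =
      pfn m a ℓ / a ^ 2 * Jf (kpa m a ℓ) (uu m θ a ℓ) := by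
  have hp := pfn_pos m a ℓ hm ha hl
  have hD := D_pos m θ a ℓ hm ha hl
  have hf : (fun a' => deriv (fun a'' => Rf m θ a'' ℓ) a') =ᶠ[nhds a]
      fun a' => pfn m a' ℓ * Bf (kpa m a' ℓ) (uu m θ a' ℓ) /
        (a' * (Real.cosh (uu m θ a' ℓ) - kpa m a' ℓ)) := by
    filter_upwards [ev_pos a ha] with s hs using Rf_deriv_a m θ s ℓ hm hs hl
  rw [hf.deriv_eq]
  have hu := uu_deriv_a m θ a ℓ hm ha hl
  have hk := kpa_deriv m a ℓ hm ha hl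
  have hB := Bf_deriv _ _ _ _ a hk hu
  have h : HasDerivAt (fun a' => pfn m a' ℓ * Bf (kpa m a' ℓ) (uu m θ a' ℓ) /
        (a' * (Real.cosh (uu m θ a' ℓ) - kpa m a' ℓ))) _ a :=
    ((pfn_deriv m a ℓ hm ha hl).mul hB).div ((hasDerivAt_id a).mul (hu.cosh.sub hk))
      (mul_pos ha hD).ne'
  rw [h.deriv]
  simp only [Pi.mul_apply, id]
  unfold Jf
  set u := uu m θ a ℓ
  set y := Real.cosh u
  set S := Real.sinh u
  set k := kpa m a ℓ
  set p := pfn m a ℓ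
  set W := Wf k u
  set B := Bf k u
  field_simp
  ring

/-! ### Inequalities -/

theorem sinh_le_mul_cosh (h : ℝ) (hh : 0 ≤ h) : Real.sinh h ≤ h * Real.cosh h := by
  have hd : ∀ x : ℝ, HasDerivAt (fun x => x * Real.cosh x - Real.sinh x) (x * Real.sinh x) x := by
    intro x
    have := ((hasDerivAt_id x).mul (Real.hasDerivAt_cosh x)).sub (Real.hasDerivAt_sinh x)
    refine this.congr_deriv ?_
    simp
  have hmono : MonotoneOn (fun x => x * Real.cosh x - Real.sinh x) (Set.Ici (0 : ℝ)) := by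
    apply monotoneOn_of_deriv_nonneg (convex_Ici 0)
    · exact fun x _ => (hd x).continuousAt.continuousWithinAt
    · exact fun x _ => (hd x).differentiableAt.differentiableWithinAt
    · intro x hx
      rw [interior_Ici] at hx
      rw [(hd x).deriv]
      have hx0 : (0 : ℝ) ≤ x := le_of_lt hx
      exact mul_nonneg hx0 (Real.sinh_nonneg_iff.2 hx0)
  have := hmono (Set.mem_Ici.2 le_rfl) (Set.mem_Ici.2 hh) hh
  simp at this
  linarith

theorem two_sinh_le (u : ℝ) (hu : 0 ≤ u) : 2 * Real.sinh u ≤ (Real.cosh u + 1) * u := by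
  have h := sinh_le_mul_cosh (u / 2) (by linarith)
  have h1 : Real.sinh u = 2 * Real.sinh (u / 2) * Real.cosh (u / 2) := by
    rw [← Real.sinh_two_mul]; congr 1; ring
  have h2 : Real.cosh u = Real.cosh (u / 2) ^ 2 + Real.sinh (u / 2) ^ 2 := by
    rw [← Real.cosh_two_mul]; congr 1; ring
  have h3 := Real.cosh_sq (u / 2)
  have h4 := Real.cosh_pos (u / 2)
  rw [h1, h2]
  have h5 : Real.sinh (u / 2) * Real.cosh (u / 2) ≤ (u / 2 * Real.cosh (u / 2)) * Real.cosh (u / 2) :=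
    mul_le_mul_of_nonneg_right h h4.le
  have h6 : Real.sinh (u / 2) ^ 2 = Real.cosh (u / 2) ^ 2 - 1 := by linarith
  rw [h6]
  nlinarith

theorem sinh_le_cosh' (u : ℝ) : Real.sinh u ≤ Real.cosh u := by
  have := Real.cosh_sub_sinh u
  have := Real.exp_pos (-u)
  linarith

/-- Basic facts about `W`. -/
theorem W_bounds (k u : ℝ) (hk0 : 0 < k) (hk1 : k < 1) (hu : 0 ≤ u) :
    0 ≤ Wf k u ∧ Wf k u ≤ 3 * (Real.cosh u - k) ∧
      Real.sinh u * Wf k u ≤ 3 * (Real.cosh u - k) ^ 2 ∧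
      (1 - k) * Real.sinh u ≤ Real.cosh u - k := by
  have h1 := two_sinh_le u hu
  have h2 := Real.self_le_sinh_iff.2 hu
  have h3 := sinh_le_cosh' u
  have h4 := Real.one_le_cosh u
  have h5 := Real.cosh_sq u
  unfold Wf
  set y := Real.cosh u
  set S := Real.sinh u
  have hS : 0 ≤ S := hu.trans h2
  have hSu : (S - u) * (y + 1) ≤ S * (y - 1) := by nlinarith
  have hSu1 : S - u ≤ y - 1 := by
    have : (S - u) * (y + 1) ≤ (y - 1) * (y + 1) := by nlinarith
    exact le_of_mul_le_mul_right this (by linarith)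
  have hSu2 : S * (S - u) ≤ (y - 1) ^ 2 := by
    have : (S * (S - u)) * (y + 1) ≤ (y - 1) ^ 2 * (y + 1) := by nlinarith
    exact le_of_mul_le_mul_right this (by linarith)
  have hdS : (1 - k) * S ≤ y - k := by nlinarith
  have hW : (1 + k ^ 2) * S - 2 * k * u = (1 - k) * ((1 - k) * S) + 2 * k * (S - u) := by ring
  have hdS0 : 0 ≤ (1 - k) * S := mul_nonneg (by linarith) hS
  have hD : 0 ≤ y - k := by linarith
  refine ⟨?_, ?_, ?_, hdS⟩
  · rw [hW]
    have := mul_nonneg (sub_nonneg.2 hk1.le) hdS0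
    have := mul_nonneg hk0.le (sub_nonneg.2 h2)
    linarith
  · rw [hW]
    have e1 : (1 - k) * ((1 - k) * S) ≤ 1 * (y - k) := by
      apply mul_le_mul (by linarith) hdS hdS0 (by norm_num)
    have e2 : k * (S - u) ≤ 1 * (y - k) := by
      apply mul_le_mul hk1.le (by linarith) (by linarith) (by norm_num)
    linarith
  · rw [hW]
    have e1 : ((1 - k) * S) * ((1 - k) * S) ≤ (y - k) * (y - k) :=
      mul_le_mul hdS hdS hdS0 hD
    have e2 : k * (S * (S - u)) ≤ 1 * (y - k) ^ 2 := by
      apply mul_le_mul hk1.le _ (mul_nonneg hS (by linarith)) (by norm_num)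
      refine hSu2.trans ?_
      apply pow_le_pow_left₀ (by linarith) (by linarith)
    nlinarith

theorem B_bound (k u : ℝ) (hk0 : 0 < k) (hk1 : k < 1) (hu : 0 ≤ u) :
    |Bf k u| ≤ 10 * ((1 + u) * (Real.cosh u - k)) := by
  have h2 := Real.self_le_sinh_iff.2 hu
  have h3 := sinh_le_cosh' u
  have h4 := Real.one_le_cosh u
  have h5 := Real.cosh_sq u
  unfold Bf
  set y := Real.cosh u
  set S := Real.sinh u
  have hS : 0 ≤ S := hu.trans h2
  have huS : u * S ≤ 3 * ((1 + u) * (y - 1)) := by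
    rcases le_total y 2 with hy | hy
    · have : u * S ≤ S * S := mul_le_mul_of_nonneg_right h2 hS
      have : 0 ≤ u * (y - 1) := mul_nonneg hu (by linarith)
      nlinarith
    · have : u * S ≤ u * (2 * (y - 1)) := mul_le_mul_of_nonneg_left (by linarith) hu
      have : 0 ≤ u * (y - 1) := mul_nonneg hu (by linarith)
      nlinarith
  have huS0 : 0 ≤ u * S := mul_nonneg hu hS
  have hB : (3 * k + k ^ 3) * y - (1 + 3 * k ^ 2) - 2 * k * (u * S) =
      (3 * k + k ^ 3) * (y - 1) - (1 - k) ^ 3 - 2 * k * (u * S) := by ring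
  rw [hB]
  have hk3 : k ^ 3 ≤ 1 := pow_le_one₀ hk0.le hk1.le
  have hk30 : 0 ≤ k ^ 3 := by positivity
  have e1 : (3 * k + k ^ 3) * (y - 1) ≤ 4 * (y - 1) :=
    mul_le_mul_of_nonneg_right (by linarith) (by linarith)
  have e10 : 0 ≤ (3 * k + k ^ 3) * (y - 1) := mul_nonneg (by positivity) (by linarith)
  have e2 : (1 - k) ^ 3 ≤ 1 - k := by
    have := pow_le_one₀ (n := 2) (sub_nonneg.2 hk1.le) (by linarith : 1 - k ≤ 1)
    nlinarith
  have e20 : 0 ≤ (1 - k) ^ 3 := pow_nonneg (by linarith) 3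
  have e3 : k * (u * S) ≤ u * S := by nlinarith
  have e30 : 0 ≤ k * (u * S) := by positivity
  have e4 : (1 + u) * (y - k) = (1 + u) * (y - 1) + (1 - k) + u * (1 - k) := by ring
  have e5 : 0 ≤ u * (1 - k) := mul_nonneg hu (by linarith)
  have e6 : 0 ≤ u * (y - 1) := mul_nonneg hu (by linarith)
  rw [abs_le]
  constructor <;> nlinarith

theorem J_bound (k u : ℝ) (hk0 : 0 < k) (hk1 : k < 1) (hu : 0 ≤ u) :
    |Jf k u| ≤ 116 * (1 + u) := by
  obtain ⟨w0, w1, w2, w3⟩ := W_bounds k u hk0 hk1 hu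
  have b := B_bound k u hk0 hk1 hu
  have h2 := Real.self_le_sinh_iff.2 hu
  have h3 := sinh_le_cosh' u
  have h4 := Real.one_le_cosh u
  unfold Jf
  set y := Real.cosh u
  set S := Real.sinh u
  set W := Wf k u
  set B := Bf k u
  have hS : 0 ≤ S := hu.trans h2
  have hD : 0 < y - k := by linarith
  set D := y - k with hDdef
  have t1 : |-(2 + k ^ 2) * (B / D)| ≤ 30 * (1 + u) := by
    rw [abs_mul, abs_div, abs_of_pos hD, abs_neg, abs_of_pos (by positivity : 0 < 2 + k ^ 2)]
    have : |B| / D ≤ 10 * (1 + u) := by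
      rw [div_le_iff₀ hD]; linarith
    calc (2 + k ^ 2) * (|B| / D) ≤ 3 * (10 * (1 + u)) := by
          apply mul_le_mul (by nlinarith) this (by positivity) (by norm_num)
      _ = _ := by ring
  have t2 : |(k * (1 + k ^ 2) * S - 2 * k * u * y) * W / D ^ 2| ≤ 12 * (1 + u) := by
    rw [abs_div, abs_of_pos (by positivity : 0 < D ^ 2), div_le_iff₀ (by positivity), abs_mul,
      abs_of_nonneg w0]
    have c1 : |k * (1 + k ^ 2) * S - 2 * k * u * y| ≤ 2 * S + 2 * (u * y) := by
      have d1 : k * (1 + k ^ 2) * S ≤ 2 * S := mul_le_mul_of_nonneg_right (by nlinarith) hS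
      have d10 : 0 ≤ k * (1 + k ^ 2) * S := by positivity
      have d2 : 0 ≤ u * y := by positivity
      have d3 : k * (u * y) ≤ u * y := by nlinarith
      have d30 : 0 ≤ k * (u * y) := by positivity
      rw [abs_le]; constructor <;> nlinarith
    refine (mul_le_mul_of_nonneg_right c1 w0).trans ?_
    have d1 : u * W ≤ S * W := mul_le_mul_of_nonneg_right h2 w0
    have d2 : (y - 1) * W ≤ D * (3 * D) := mul_le_mul (by linarith) w1 w0 hD.le
    have d3 : u * ((y - 1) * W) ≤ u * (D * (3 * D)) := mul_le_mul_of_nonneg_left d2 hu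
    have d4 : 0 ≤ u * D ^ 2 := by positivity
    nlinarith
  have t3 : |B * S * W / D ^ 3| ≤ 30 * (1 + u) := by
    rw [abs_div, abs_of_pos (by positivity : 0 < D ^ 3), div_le_iff₀ (by positivity), mul_assoc,
      abs_mul, abs_of_nonneg (mul_nonneg hS w0)]
    calc |B| * (S * W) ≤ (10 * ((1 + u) * D)) * (3 * D ^ 2) :=
          mul_le_mul b w2 (mul_nonneg hS w0) (by positivity)
      _ = _ := by ring
  have hkk0 : 0 ≤ k * (1 - k ^ 2) := mul_nonneg hk0.le (by nlinarith)
  have hkk : k * (1 - k ^ 2) ≤ 2 * (1 - k) := by nlinarith [mul_pos hk0 (sub_pos.2 hk1)]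
  have hdD : 1 - k ≤ D := by linarith
  have t4 : |k * (1 - k ^ 2) * (((3 + 3 * k ^ 2) * y - 6 * k - 2 * (u * S)) / D + B / D ^ 2)|
      ≤ 44 * (1 + u) := by
    have c1 : |(3 + 3 * k ^ 2) * y - 6 * k - 2 * (u * S)| ≤ 12 * ((1 + u) * y) := by
      have d1 : (3 + 3 * k ^ 2) * y ≤ 6 * y := mul_le_mul_of_nonneg_right (by nlinarith) (by linarith)
      have d10 : 0 ≤ (3 + 3 * k ^ 2) * y := by positivity
      have d2 : u * S ≤ u * y := mul_le_mul_of_nonneg_left h3 hu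
      have d20 : 0 ≤ u * S := mul_nonneg hu hS
      rw [abs_le]; constructor <;> nlinarith
    have c2 : (1 - k) * y ≤ D := by nlinarith
    rw [mul_add]
    refine (abs_add_le _ _).trans ?_
    have s1 : |k * (1 - k ^ 2) * (((3 + 3 * k ^ 2) * y - 6 * k - 2 * (u * S)) / D)| ≤
        24 * (1 + u) := by
      rw [abs_mul, abs_of_nonneg hkk0, abs_div, abs_of_pos hD, ← mul_div_assoc, div_le_iff₀ hD]
      refine (mul_le_mul hkk c1 (abs_nonneg _) (by linarith)).trans ?_
      have : (1 + u) * ((1 - k) * y) ≤ (1 + u) * D := mul_le_mul_of_nonneg_left c2 (by linarith)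
      nlinarith
    have s2 : |k * (1 - k ^ 2) * (B / D ^ 2)| ≤ 20 * (1 + u) := by
      rw [abs_mul, abs_of_nonneg hkk0, abs_div, abs_of_pos (by positivity : 0 < D ^ 2),
        ← mul_div_assoc, div_le_iff₀ (by positivity)]
      refine (mul_le_mul hkk b (abs_nonneg _) (by linarith)).trans ?_
      have : (1 - k) * ((1 + u) * D) ≤ D * ((1 + u) * D) :=
        mul_le_mul_of_nonneg_right hdD (by positivity)
      nlinarith
    linarith
  have := abs_le.1 t1
  have := abs_le.1 t2
  have := abs_le.1 t3
  have := abs_le.1 t4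
  rw [abs_le]
  constructor <;> linarith

theorem Wf_neg (k u : ℝ) : Wf k (-u) = -Wf k u := by
  unfold Wf; rw [Real.sinh_neg]; ring

theorem Bf_neg (k u : ℝ) : Bf k (-u) = Bf k u := by
  unfold Bf; rw [Real.sinh_neg, Real.cosh_neg]; ring

theorem Jf_neg (k u : ℝ) : Jf k (-u) = Jf k u := by
  unfold Jf; rw [Real.sinh_neg, Real.cosh_neg, Bf_neg, Wf_neg]; ring

theorem J_bound' (k u : ℝ) (hk0 : 0 < k) (hk1 : k < 1) : |Jf k u| ≤ 116 * (1 + |u|) := by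
  have h := J_bound k |u| hk0 hk1 (abs_nonneg u)
  rcases abs_choice u with h1 | h1
  · rw [h1] at h ⊢; exact h
  · rw [h1, Jf_neg] at h; rw [h1]; exact h

theorem mixed_bound (k u : ℝ) (hk0 : 0 < k) (hk1 : k < 1) (hu : 0 ≤ u) :
    |(1 - k * Real.cosh u) * Wf k u / (Real.cosh u - k) ^ 3 -
        k * (1 - k ^ 2) * Real.sinh u / (Real.cosh u - k) ^ 2| ≤ 5 * (1 / (Real.cosh u - k)) := by
  obtain ⟨w0, w1, w2, w3⟩ := W_bounds k u hk0 hk1 hu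
  have h2 := Real.self_le_sinh_iff.2 hu
  have h4 := Real.one_le_cosh u
  set y := Real.cosh u
  set S := Real.sinh u
  set W := Wf k u
  have hS : 0 ≤ S := hu.trans h2
  have hD : 0 < y - k := by linarith
  have hn : |1 - k * y| ≤ y - k := by
    rw [abs_le]; constructor <;> nlinarith
  set D := y - k with hDdef
  have hkk0 : 0 ≤ k * (1 - k ^ 2) := mul_nonneg hk0.le (by nlinarith)
  have hkk : k * (1 - k ^ 2) ≤ 2 * (1 - k) := by nlinarith [mul_pos hk0 (sub_pos.2 hk1)]
  have t1 : |(1 - k * y) * W / D ^ 3| ≤ 3 * (1 / D) := by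
    rw [abs_div, abs_of_pos (by positivity : 0 < D ^ 3), div_le_iff₀ (by positivity), abs_mul,
      abs_of_nonneg w0]
    calc |1 - k * y| * W ≤ D * (3 * D) := mul_le_mul hn w1 w0 hD.le
      _ = _ := by field_simp
  have t2 : |k * (1 - k ^ 2) * S / D ^ 2| ≤ 2 * (1 / D) := by
    rw [abs_div, abs_of_pos (by positivity : 0 < D ^ 2), div_le_iff₀ (by positivity),
      abs_of_nonneg (mul_nonneg hkk0 hS)]
    calc k * (1 - k ^ 2) * S ≤ 2 * (1 - k) * S := mul_le_mul_of_nonneg_right hkk hS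
      _ ≤ 2 * D := by linarith
      _ = _ := by field_simp
  have := abs_le.1 t1
  have := abs_le.1 t2
  rw [abs_le]
  constructor <;> linarith

theorem mixed_bound' (k u : ℝ) (hk0 : 0 < k) (hk1 : k < 1) :
    |(1 - k * Real.cosh u) * Wf k u / (Real.cosh u - k) ^ 3 -
        k * (1 - k ^ 2) * Real.sinh u / (Real.cosh u - k) ^ 2| ≤ 5 * (1 / (Real.cosh u - k)) := by
  rcases le_total 0 u with hu | hu
  · exact mixed_bound k u hk0 hk1 hu
  · have h := mixed_bound k (-u) hk0 hk1 (by linarith)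
    rw [Wf_neg, Real.cosh_neg, Real.sinh_neg] at h
    rw [← abs_neg]
    convert h using 2
    ring

theorem log_bound (k u : ℝ) (hk0 : 0 < k) (hk1 : k < 1) :
    1 + |u| ≤ 7 * Real.log (jb (Real.cosh u - k)) := by
  have h4 := Real.one_le_cosh u
  set D := Real.cosh u - k with hDdef
  have hD : 0 < D := by linarith
  have hj : Real.log (jb D) = Real.log (2 + D ^ 2) / 2 := by
    unfold jb; rw [Real.log_sqrt (by positivity)]
  have h5 : Real.exp |u| ≤ 2 * (D + 1) := by
    have : Real.exp |u| ≤ 2 * Real.cosh |u| := by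
      rw [Real.cosh_eq]; have := Real.exp_pos (-|u|); linarith
    rw [Real.cosh_abs] at this
    linarith
  have hl2 : Real.log 2 ≤ Real.log (2 + D ^ 2) := Real.log_le_log (by norm_num) (by nlinarith)
  have hlog2 := Real.log_two_gt_d9
  have h6 : |u| ≤ 2 * Real.log (2 + D ^ 2) := by
    have h7 : Real.exp |u| ≤ (2 + D ^ 2) ^ 2 := by
      refine h5.trans ?_
      nlinarith [sq_nonneg (D ^ 2), sq_nonneg (D - 1)]
    have := Real.log_le_log (Real.exp_pos _) h7
    rw [Real.log_exp, Real.log_pow] at this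
    exact_mod_cast this
  rw [hj]
  linarith

/-! ### Comparison of parameters -/

/-- A constant depending only on `m`. -/
def cm (m : ℝ) : ℝ := 2 + m + 2 / m

theorem cm_ge (m : ℝ) (hm : 0 < m) : 2 ≤ cm m ∧ m ≤ cm m ∧ 2 / m ≤ cm m := by
  have : 0 < 2 / m := by positivity
  unfold cm
  refine ⟨?_, ?_, ?_⟩ <;> linarith

theorem jb_pos (x : ℝ) : 0 < jb x := by unfold jb; positivity

theorem jb_sq (x : ℝ) : jb x ^ 2 = 2 + x ^ 2 := by
  unfold jb; exact Real.sq_sqrt (by positivity)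

theorem jb_sq' (a ℓ : ℝ) (hl : 0 < ℓ) : jb (a * Real.sqrt ℓ) ^ 2 = 2 + a ^ 2 * ℓ := by
  rw [jb_sq, mul_pow, Real.sq_sqrt hl.le]

theorem kj_upper (m a ℓ : ℝ) (hm : 0 < m) (hl : 0 < ℓ) :
    kpa m a ℓ * jb (a * Real.sqrt ℓ) ≤ cm m := by
  obtain ⟨c1, c2, c3⟩ := cm_ge m hm
  have hk := kpa_sq m a ℓ hm hl
  have hj := jb_sq' a ℓ hl
  refine (sq_le_sq₀ (mul_pos (kpa_pos m a ℓ hm hl) (jb_pos _)).le (by linarith)).1 ?_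
  rw [mul_pow, hj]
  have hz : 0 ≤ a ^ 2 * ℓ := by positivity
  have e1 : 1 ≤ cm m ^ 2 / m ^ 2 := by
    rw [le_div_iff₀ (by positivity)]; nlinarith
  have e2 : 2 + a ^ 2 * ℓ ≤ cm m ^ 2 * (1 + 4 * a ^ 2 * ℓ / m ^ 2) := by
    have : cm m ^ 2 * (1 + 4 * a ^ 2 * ℓ / m ^ 2) =
      cm m ^ 2 + 4 * (a ^ 2 * ℓ) * (cm m ^ 2 / m ^ 2) := by ring
    rw [this]; nlinarith
  calc kpa m a ℓ ^ 2 * (2 + a ^ 2 * ℓ)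
      ≤ kpa m a ℓ ^ 2 * (cm m ^ 2 * (1 + 4 * a ^ 2 * ℓ / m ^ 2)) :=
        mul_le_mul_of_nonneg_left e2 (by positivity)
    _ = cm m ^ 2 * (kpa m a ℓ ^ 2 * (1 + 4 * a ^ 2 * ℓ / m ^ 2)) := by ring
    _ = cm m ^ 2 := by rw [hk, mul_one]

theorem kj_lower (m a ℓ : ℝ) (hm : 0 < m) (hl : 0 < ℓ) :
    1 ≤ cm m * (kpa m a ℓ * jb (a * Real.sqrt ℓ)) := by
  obtain ⟨c1, c2, c3⟩ := cm_ge m hm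
  have hk := kpa_sq m a ℓ hm hl
  have hk0 := kpa_pos m a ℓ hm hl
  have hj := jb_sq' a ℓ hl
  have hj0 := jb_pos (a * Real.sqrt ℓ)
  refine (sq_le_sq₀ (by norm_num) (by positivity)).1 ?_
  rw [mul_pow, mul_pow, hj, one_pow]
  have hz : 0 ≤ a ^ 2 * ℓ := by positivity
  have e1 : 4 / m ^ 2 ≤ cm m ^ 2 := by
    have : 4 / m ^ 2 = (2 / m) ^ 2 := by rw [div_pow]; norm_num
    rw [this]
    exact pow_le_pow_left₀ (by positivity) c3 2
  have e2 : 1 + 4 * a ^ 2 * ℓ / m ^ 2 ≤ cm m ^ 2 * (2 + a ^ 2 * ℓ) := by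
    have : 1 + 4 * a ^ 2 * ℓ / m ^ 2 = 1 + (a ^ 2 * ℓ) * (4 / m ^ 2) := by ring
    rw [this]
    nlinarith
  calc (1 : ℝ) = kpa m a ℓ ^ 2 * (1 + 4 * a ^ 2 * ℓ / m ^ 2) := hk.symm
    _ ≤ kpa m a ℓ ^ 2 * (cm m ^ 2 * (2 + a ^ 2 * ℓ)) :=
        mul_le_mul_of_nonneg_left e2 (by positivity)
    _ = _ := by ring

theorem inv_k_le (m a ℓ : ℝ) (hm : 0 < m) (hl : 0 < ℓ) :
    1 / kpa m a ℓ ≤ cm m * jb (a * Real.sqrt ℓ) := by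
  have hk0 := kpa_pos m a ℓ hm hl
  rw [div_le_iff₀ hk0]
  have := kj_lower m a ℓ hm hl
  linarith

theorem pfn_eq (m a ℓ : ℝ) : pfn m a ℓ = m / 2 * ((a ^ 2)⁻¹ * (1 / kpa m a ℓ)) := by
  unfold pfn
  simp only [div_eq_mul_inv, mul_inv]
  ring

theorem p_upper (m a ℓ : ℝ) (hm : 0 < m) (ha : 0 < a) (hl : 0 < ℓ) :
    |deriv (fun a' => deriv (fun a'' => pfn m a'' ℓ) a') a| ≤
          (7 / 2 * m * cm m) * ((a ^ 4)⁻¹ * jb (a * Real.sqrt ℓ)) := by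
  have hk0 := kpa_pos m a ℓ hm hl
  have hk1 := kpa_lt_one m a ℓ hm ha hl
  have hp := pfn_pos m a ℓ hm ha hl
  have hkk : kpa m a ℓ ^ 2 ≤ 1 := pow_le_one₀ hk0.le hk1.le
  have hkk4 : kpa m a ℓ ^ 4 ≤ 1 := pow_le_one₀ hk0.le hk1.le
  rw [pfn_deriv2 m a ℓ hm ha hl, abs_of_nonneg]
  · have hi := inv_k_le m a ℓ hm hl
    have e : pfn m a ℓ ≤ m / 2 * ((a ^ 2)⁻¹ * (cm m * jb (a * Real.sqrt ℓ))) := by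
      rw [pfn_eq]; gcongr
    have e2 : pfn m a ℓ * (2 + 5 * kpa m a ℓ ^ 2 - kpa m a ℓ ^ 4) ≤ pfn m a ℓ * 7 := by
      apply mul_le_mul_of_nonneg_left _ hp.le
      have : 0 ≤ kpa m a ℓ ^ 4 := by positivity
      linarith
    calc pfn m a ℓ * (2 + 5 * kpa m a ℓ ^ 2 - kpa m a ℓ ^ 4) / a ^ 2
        ≤ (m / 2 * ((a ^ 2)⁻¹ * (cm m * jb (a * Real.sqrt ℓ)))) * 7 / a ^ 2 := by
          apply div_le_div_of_nonneg_right _ (by positivity)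
          exact e2.trans (mul_le_mul_of_nonneg_right e (by norm_num))
      _ = _ := by field_simp
  · apply div_nonneg _ (by positivity)
    apply mul_nonneg hp.le
    nlinarith

theorem p_lower (m a ℓ : ℝ) (hm : 0 < m) (ha : 0 < a) (hl : 0 < ℓ) :
    (a ^ 4)⁻¹ * jb (a * Real.sqrt ℓ) ≤
      (cm m / m) * |deriv (fun a' => deriv (fun a'' => pfn m a'' ℓ) a') a| := by
  have hk0 := kpa_pos m a ℓ hm hl
  have hk1 := kpa_lt_one m a ℓ hm ha hl
  have hp := pfn_pos m a ℓ hm ha hl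
  have hkk : kpa m a ℓ ^ 2 ≤ 1 := pow_le_one₀ hk0.le hk1.le
  have hc := cm_ge m hm
  have hc0 : 0 < cm m := by linarith
  have h1 : pfn m a ℓ * 2 / a ^ 2 ≤
      |deriv (fun a' => deriv (fun a'' => pfn m a'' ℓ) a') a| := by
    refine le_trans ?_ (le_abs_self _)
    rw [pfn_deriv2 m a ℓ hm ha hl]
    gcongr
    nlinarith
  have h2 : jb (a * Real.sqrt ℓ) ≤ cm m * (1 / kpa m a ℓ) := by
    have := kj_upper m a ℓ hm hl
    rw [mul_one_div, le_div_iff₀ hk0]; linarith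
  calc (a ^ 4)⁻¹ * jb (a * Real.sqrt ℓ) ≤ (a ^ 4)⁻¹ * (cm m * (1 / kpa m a ℓ)) := by gcongr
    _ = (cm m / m) * (pfn m a ℓ * 2 / a ^ 2) := by
        rw [pfn_eq]; field_simp
    _ ≤ _ := by gcongr

theorem one_sub_ksq (m a ℓ : ℝ) (hm : 0 < m) (hl : 0 < ℓ) :
    1 - kpa m a ℓ ^ 2 = kpa m a ℓ ^ 2 * (4 * (a ^ 2 * ℓ) / m ^ 2) := by
  have h := kpa_sq m a ℓ hm hl
  linear_combination (-1 : ℝ) * h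

theorem k_upper (m a ℓ : ℝ) (hm : 0 < m) (ha : 0 < a) (hl : 0 < ℓ) :
    |deriv (fun a' => deriv (fun a'' => kpa m a'' ℓ) a') a| ≤
        (2 * cm m ^ 3) * ((a ^ 2)⁻¹ * (jb (a * Real.sqrt ℓ))⁻¹ * min 1 (a ^ 2 * ℓ)) := by
  have hk0 := kpa_pos m a ℓ hm hl
  have hk1 := kpa_lt_one m a ℓ hm ha hl
  obtain ⟨c1, c2, c3⟩ := cm_ge m hm
  have hkk : kpa m a ℓ ^ 2 ≤ 1 := pow_le_one₀ hk0.le hk1.le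
  have hj0 := jb_pos (a * Real.sqrt ℓ)
  have h1 : kpa m a ℓ ≤ cm m * (jb (a * Real.sqrt ℓ))⁻¹ := by
    rw [← div_eq_mul_inv, le_div_iff₀ hj0]; exact kj_upper m a ℓ hm hl
  have hz : 0 < a ^ 2 * ℓ := by positivity
  have h2 : 1 - kpa m a ℓ ^ 2 ≤ cm m ^ 2 * min 1 (a ^ 2 * ℓ) := by
    rw [mul_min_of_nonneg _ _ (by positivity), le_min_iff]
    constructor
    · nlinarith
    · rw [one_sub_ksq m a ℓ hm hl]
      have e1 : 4 / m ^ 2 ≤ cm m ^ 2 := by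
        have : 4 / m ^ 2 = (2 / m) ^ 2 := by rw [div_pow]; norm_num
        rw [this]
        exact pow_le_pow_left₀ (by positivity) c3 2
      calc kpa m a ℓ ^ 2 * (4 * (a ^ 2 * ℓ) / m ^ 2)
          = kpa m a ℓ ^ 2 * ((4 / m ^ 2) * (a ^ 2 * ℓ)) := by ring
        _ ≤ 1 * (cm m ^ 2 * (a ^ 2 * ℓ)) := by gcongr
        _ = _ := by ring
  have h3 : |2 - 3 * kpa m a ℓ ^ 2| ≤ 2 := by
    rw [abs_le]; constructor <;> nlinarith
  have h20 : 0 ≤ 1 - kpa m a ℓ ^ 2 := by linarith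
  rw [kpa_deriv2 m a ℓ hm ha hl, abs_div, abs_mul, abs_of_nonneg (mul_nonneg hk0.le h20),
    abs_of_pos (by positivity : 0 < a ^ 2)]
  calc kpa m a ℓ * (1 - kpa m a ℓ ^ 2) * |2 - 3 * kpa m a ℓ ^ 2| / a ^ 2
      ≤ (cm m * (jb (a * Real.sqrt ℓ))⁻¹) * (cm m ^ 2 * min 1 (a ^ 2 * ℓ)) * 2 / a ^ 2 := by
        gcongr
    _ = _ := by ring

theorem D_lower (m θ a ℓ : ℝ) (hm : 0 < m) (ha : 0 < a) (hl : 0 < ℓ) :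
    kpa m a ℓ ^ 2 * (2 * (a ^ 2 * ℓ) / m ^ 2) ≤ Real.cosh (uu m θ a ℓ) - kpa m a ℓ := by
  have hk0 := kpa_pos m a ℓ hm hl
  have hk1 := kpa_lt_one m a ℓ hm ha hl
  have h := one_sub_ksq m a ℓ hm hl
  have h1 := Real.one_le_cosh (uu m θ a ℓ)
  have : kpa m a ℓ ^ 2 * (2 * (a ^ 2 * ℓ) / m ^ 2) = (1 - kpa m a ℓ ^ 2) / 2 := by
    rw [h]; ring
  rw [this]
  nlinarith

theorem tt_bound (m θ a ℓ : ℝ) (hm : 0 < m) (ha : 0 < a) (hl : 0 < ℓ) :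
    |deriv (fun θ' => deriv (fun θ'' => Rf m θ'' a ℓ) θ') θ| ≤
            1 * (pfn m a ℓ / Rf m θ a ℓ ^ 2) := by
  have hk0 := kpa_pos m a ℓ hm hl
  have hk1 := kpa_lt_one m a ℓ hm ha hl
  have hp := pfn_pos m a ℓ hm ha hl
  have hD := D_pos m θ a ℓ hm ha hl
  have h4 := Real.one_le_cosh (uu m θ a ℓ)
  rw [Rf_deriv_theta2 m θ a ℓ hm ha hl, Rf_eq m θ a ℓ hm ha hl]
  set y := Real.cosh (uu m θ a ℓ)
  set k := kpa m a ℓ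
  set p := pfn m a ℓ
  have hn : |1 - k * y| ≤ y - k := by
    rw [abs_le]; constructor <;> nlinarith
  rw [abs_div, abs_of_pos (by positivity : 0 < p * (y - k) ^ 3)]
  calc |1 - k * y| / (p * (y - k) ^ 3) ≤ (y - k) / (p * (y - k) ^ 3) := by gcongr
    _ = _ := by field_simp

theorem tt_bound2 (m θ a ℓ : ℝ) (hm : 0 < m) (ha : 0 < a) (hl : 0 < ℓ) :
    pfn m a ℓ / Rf m θ a ℓ ^ 2 ≤
      (m ^ 3 / 2 * cm m ^ 3) * ((a ^ 2)⁻¹ * (ℓ ^ 2)⁻¹ * jb (a * Real.sqrt ℓ) ^ 3) := by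
  have hk0 := kpa_pos m a ℓ hm hl
  have hp := pfn_pos m a ℓ hm ha hl
  have hD := D_pos m θ a ℓ hm ha hl
  have hDl := D_lower m θ a ℓ hm ha hl
  have hi := inv_k_le m a ℓ hm hl
  rw [Rf_eq m θ a ℓ hm ha hl]
  calc pfn m a ℓ / (pfn m a ℓ * (Real.cosh (uu m θ a ℓ) - kpa m a ℓ)) ^ 2
      ≤ pfn m a ℓ / (pfn m a ℓ * (kpa m a ℓ ^ 2 * (2 * (a ^ 2 * ℓ) / m ^ 2))) ^ 2 := by
        gcongr
    _ = m ^ 3 / 2 * ((a ^ 2)⁻¹ * (ℓ ^ 2)⁻¹ * (1 / kpa m a ℓ) ^ 3) := by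
        unfold pfn
        set k := kpa m a ℓ
        field_simp
        try ring
    _ ≤ m ^ 3 / 2 * ((a ^ 2)⁻¹ * (ℓ ^ 2)⁻¹ * (cm m * jb (a * Real.sqrt ℓ)) ^ 3) := by
        gcongr
    _ = _ := by ring

theorem p_div_R (m θ a ℓ : ℝ) (hm : 0 < m) (ha : 0 < a) (hl : 0 < ℓ) :
    pfn m a ℓ / Rf m θ a ℓ = 1 / (Real.cosh (uu m θ a ℓ) - kpa m a ℓ) := by
  have hp := pfn_pos m a ℓ hm ha hl
  have hD := D_pos m θ a ℓ hm ha hl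
  rw [Rf_eq m θ a ℓ hm ha hl]
  field_simp

theorem ta_bound (m θ a ℓ : ℝ) (hm : 0 < m) (ha : 0 < a) (hl : 0 < ℓ) :
    |deriv (fun a' => deriv (fun θ' => Rf m θ' a' ℓ) θ) a| ≤
            5 * ((1 / a) * (pfn m a ℓ / Rf m θ a ℓ)) := by
  have hk0 := kpa_pos m a ℓ hm hl
  have hk1 := kpa_lt_one m a ℓ hm ha hl
  have h := mixed_bound' (kpa m a ℓ) (uu m θ a ℓ) hk0 hk1
  have ha' : 0 < 1 / a := by positivity
  rw [Rf_deriv_mixed m θ a ℓ hm ha hl, p_div_R m θ a ℓ hm ha hl, abs_mul, abs_of_pos ha']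
  have := mul_le_mul_of_nonneg_left h ha'.le
  linarith

theorem ta_bound2 (m θ a ℓ : ℝ) (hm : 0 < m) (ha : 0 < a) (hl : 0 < ℓ) :
    (1 / a) * (pfn m a ℓ / Rf m θ a ℓ) ≤
      (1 + m ^ 2 / 2) * ((1 / a) * jb (1 / (a * Real.sqrt ℓ)) ^ 2) := by
  have hk0 := kpa_pos m a ℓ hm hl
  have hD := D_pos m θ a ℓ hm ha hl
  have hDl := D_lower m θ a ℓ hm ha hl
  have hks := kpa_sq m a ℓ hm hl
  rw [p_div_R m θ a ℓ hm ha hl, jb_sq, div_pow, mul_pow, Real.sq_sqrt hl.le]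
  have h1 : 1 / (Real.cosh (uu m θ a ℓ) - kpa m a ℓ) ≤
      1 / (kpa m a ℓ ^ 2 * (2 * (a ^ 2 * ℓ) / m ^ 2)) := by gcongr
  have h2 : 1 / (kpa m a ℓ ^ 2 * (2 * (a ^ 2 * ℓ) / m ^ 2)) = 2 + m ^ 2 / 2 * (1 / (a ^ 2 * ℓ)) := by
    have h3 : kpa m a ℓ ^ 2 * (m ^ 2 + 4 * a ^ 2 * ℓ) = m ^ 2 := by
      have : m ^ 2 + 4 * a ^ 2 * ℓ = m ^ 2 * (1 + 4 * a ^ 2 * ℓ / m ^ 2) := by field_simp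
      rw [this]; linear_combination m ^ 2 * hks
    rw [div_eq_iff (by positivity)]
    set k := kpa m a ℓ
    field_simp
    linear_combination (-1 : ℝ) * h3
  have hz : 0 < 1 / (a ^ 2 * ℓ) := by positivity
  have h4 : 1 / (Real.cosh (uu m θ a ℓ) - kpa m a ℓ) ≤
      (1 + m ^ 2 / 2) * (2 + 1 ^ 2 / (a ^ 2 * ℓ)) := by
    rw [one_pow]
    refine (h1.trans h2.le).trans ?_
    nlinarith [sq_nonneg m]
  have := mul_le_mul_of_nonneg_left h4 (by positivity : 0 ≤ 1 / a)
  linarith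

theorem aa_bound (m θ a ℓ : ℝ) (hm : 0 < m) (ha : 0 < a) (hl : 0 < ℓ) :
    |deriv (fun a' => deriv (fun a'' => Rf m θ a'' ℓ) a') a| ≤
          812 * (pfn m a ℓ / a ^ 2) * Real.log (jb (Rf m θ a ℓ / pfn m a ℓ)) := by
  have hk0 := kpa_pos m a ℓ hm hl
  have hk1 := kpa_lt_one m a ℓ hm ha hl
  have hp := pfn_pos m a ℓ hm ha hl
  have hR : Rf m θ a ℓ / pfn m a ℓ = Real.cosh (uu m θ a ℓ) - kpa m a ℓ := by
    rw [Rf_eq m θ a ℓ hm ha hl]; field_simp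
  rw [hR, Rf_deriv_a2 m θ a ℓ hm ha hl, abs_mul, abs_of_pos (by positivity : 0 < pfn m a ℓ / a ^ 2)]
  have h1 := J_bound' (kpa m a ℓ) (uu m θ a ℓ) hk0 hk1
  have h2 := log_bound (kpa m a ℓ) (uu m θ a ℓ) hk0 hk1
  have h3 : |Jf (kpa m a ℓ) (uu m θ a ℓ)| ≤
      812 * Real.log (jb (Real.cosh (uu m θ a ℓ) - kpa m a ℓ)) := by linarith
  have := mul_le_mul_of_nonneg_left h3 (by positivity : 0 ≤ pfn m a ℓ / a ^ 2)
  linarith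

/-- estimates on the second order derivatives of `p`, `κ` and `R` (constants
depending only on `m`). -/
theorem statement10 (m : ℝ) (hm : 0 < m) :
    ∃ C : ℝ, 0 < C ∧ ∀ a ℓ : ℝ, 0 < a → 0 < ℓ →
      (|deriv (fun a' => deriv (fun a'' => pfn m a'' ℓ) a') a| ≤
          C * ((a ^ 4)⁻¹ * jb (a * Real.sqrt ℓ)) ∧
        (a ^ 4)⁻¹ * jb (a * Real.sqrt ℓ) ≤
          C * |deriv (fun a' => deriv (fun a'' => pfn m a'' ℓ) a') a|) ∧
      |deriv (fun a' => deriv (fun a'' => kpa m a'' ℓ) a') a| ≤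
        C * ((a ^ 2)⁻¹ * (jb (a * Real.sqrt ℓ))⁻¹ * min 1 (a ^ 2 * ℓ)) ∧
      ∀ θ : ℝ, θ ≠ 0 →
        (|deriv (fun θ' => deriv (fun θ'' => Rf m θ'' a ℓ) θ') θ| ≤
            C * (pfn m a ℓ / Rf m θ a ℓ ^ 2) ∧
          pfn m a ℓ / Rf m θ a ℓ ^ 2 ≤
            C * ((a ^ 2)⁻¹ * (ℓ ^ 2)⁻¹ * jb (a * Real.sqrt ℓ) ^ 3)) ∧
        (|deriv (fun a' => deriv (fun θ' => Rf m θ' a' ℓ) θ) a| ≤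
            C * ((1 / a) * (pfn m a ℓ / Rf m θ a ℓ)) ∧
          (1 / a) * (pfn m a ℓ / Rf m θ a ℓ) ≤
            C * ((1 / a) * jb (1 / (a * Real.sqrt ℓ)) ^ 2)) ∧
        |deriv (fun a' => deriv (fun a'' => Rf m θ a'' ℓ) a') a| ≤
          C * (pfn m a ℓ / a ^ 2) * Real.log (jb (Rf m θ a ℓ / pfn m a ℓ)) := by
  have hc := cm_ge m hm
  have hc0 : 0 < cm m := by linarith
  have q1 : 0 ≤ 7 / 2 * m * cm m := by positivity
  have q2 : 0 ≤ cm m / m := by positivity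
  have q3 : 0 ≤ 2 * cm m ^ 3 := by positivity
  have q4 : 0 ≤ m ^ 3 / 2 * cm m ^ 3 := by positivity
  have q5 : 0 ≤ 1 + m ^ 2 / 2 := by positivity
  refine ⟨7 / 2 * m * cm m + cm m / m + 2 * cm m ^ 3 + m ^ 3 / 2 * cm m ^ 3 + (1 + m ^ 2 / 2) + 818,
    by linarith, ?_⟩
  intro a ℓ ha hl
  have hj := jb_pos (a * Real.sqrt ℓ)
  have hj' := jb_pos (1 / (a * Real.sqrt ℓ))
  have hp := pfn_pos m a ℓ hm ha hl
  refine ⟨⟨?_, ?_⟩, ?_, ?_⟩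
  · exact (p_upper m a ℓ hm ha hl).trans (mul_le_mul_of_nonneg_right (by linarith) (by positivity))
  · exact (p_lower m a ℓ hm ha hl).trans (mul_le_mul_of_nonneg_right (by linarith) (abs_nonneg _))
  · exact (k_upper m a ℓ hm ha hl).trans (mul_le_mul_of_nonneg_right (by linarith) (by positivity))
  intro θ _
  have hD := D_pos m θ a ℓ hm ha hl
  have hR : 0 < Rf m θ a ℓ := by rw [Rf_eq m θ a ℓ hm ha hl]; positivity
  refine ⟨⟨?_, ?_⟩, ⟨?_, ?_⟩, ?_⟩
  · exact (tt_bound m θ a ℓ hm ha hl).trans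
      (mul_le_mul_of_nonneg_right (by linarith) (by positivity))
  · exact (tt_bound2 m θ a ℓ hm ha hl).trans
      (mul_le_mul_of_nonneg_right (by linarith) (by positivity))
  · exact (ta_bound m θ a ℓ hm ha hl).trans
      (mul_le_mul_of_nonneg_right (by linarith) (by positivity))
  · exact (ta_bound2 m θ a ℓ hm ha hl).trans
      (mul_le_mul_of_nonneg_right (by linarith) (by positivity))
  · have hlog : 0 ≤ Real.log (jb (Rf m θ a ℓ / pfn m a ℓ)) := by
      apply Real.log_nonneg
      unfold jb
      rw [Real.one_le_sqrt]
      have : 0 ≤ (Rf m θ a ℓ / pfn m a ℓ) ^ 2 := by positivity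
      linarith
    refine (aa_bound m θ a ℓ hm ha hl).trans ?_
    rw [mul_assoc, mul_assoc]
    exact mul_le_mul_of_nonneg_right (by linarith) (by positivity)
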